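/- Let n ∈ ℕ, let A, R ∈ M_n(ℂ), let U ∈ M_n(ℂ) be unitary, and let ‖·‖ be a unitarily invariant norm on M_n(ℂ). Then ‖AUR‖ ≤ √(tr(A*A)) · ‖R‖, where AUR is the ordinary matrix product (the same bound holds with either or both products replaced by Hadamard products). -/

import Mathlib

open Matrix

/-- A unitarily invariant norm on `M_n(ℂ)`: a norm `N` with `N (U * A * V) = N A`
for all unitary `U, V`. -/
structure UnitarilyInvariantNorm (d : ℕ) where
  N : Matrix (Fin d) (Fin d) ℂ → ℝ
  nonneg : ∀ A, 0 ≤ N A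
  definite : ∀ A, N A = 0 → A = 0
  triangle : ∀ A B, N (A + B) ≤ N A + N B
  homog : ∀ (c : ℂ) (A : Matrix (Fin d) (Fin d) ℂ), N (c • A) = ‖c‖ * N A
  unitary_inv : ∀ (A U V : Matrix (Fin d) (Fin d) ℂ),
    U ∈ Matrix.unitaryGroup (Fin d) ℂ → V ∈ Matrix.unitaryGroup (Fin d) ℂ →
      N (U * A * V) = N A

/-- `mprod true` is the ordinary matrix product, `mprod false` the Hadamard product. -/
noncomputable def mprod {d : ℕ} (b : Bool) (A B : Matrix (Fin d) (Fin d) ℂ) :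
    Matrix (Fin d) (Fin d) ℂ :=
  if b then A * B else Matrix.hadamard A B

namespace UnitarilyInvariantNorm

variable {n : ℕ} (Nn : UnitarilyInvariantNorm n)

lemma map_zero : Nn.N 0 = 0 := by
  simpa using Nn.homog 0 0

lemma sum_le {ι : Type*} (s : Finset ι) (f : ι → Matrix (Fin n) (Fin n) ℂ) :
    Nn.N (∑ i ∈ s, f i) ≤ ∑ i ∈ s, Nn.N (f i) := by
  classical
  induction s using Finset.induction_on with
  | empty => simp [Nn.map_zero]
  | insert a s ha ih =>
    rw [Finset.sum_insert ha, Finset.sum_insert ha]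
    exact (Nn.triangle _ _).trans (by gcongr)

lemma unitary_mul {U : Matrix (Fin n) (Fin n) ℂ} (hU : U ∈ unitaryGroup (Fin n) ℂ)
    (A : Matrix (Fin n) (Fin n) ℂ) : Nn.N (U * A) = Nn.N A := by
  simpa using Nn.unitary_inv A U 1 hU (one_mem _)

end UnitarilyInvariantNorm

section Frobenius

lemma re_trace_conjTranspose_mul_self {m n : Type*} [Fintype m] [Fintype n]
    (A : Matrix m n ℂ) : (trace (Aᴴ * A)).re = ∑ i, ∑ j, ‖A i j‖ ^ 2 := by
  rw [Finset.sum_comm]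
  simp [trace, mul_apply, ← Complex.normSq_eq_norm_sq, Complex.normSq_apply]

lemma trace_conjTranspose_mul_self_mul_unitary {n : Type*} [Fintype n] [DecidableEq n]
    (A : Matrix n n ℂ) {U : Matrix n n ℂ} (hU : U ∈ unitaryGroup n ℂ) :
    trace ((A * U)ᴴ * (A * U)) = trace (Aᴴ * A) := by
  have h : U * Uᴴ = 1 := mem_unitaryGroup_iff.mp hU
  rw [trace_mul_comm, conjTranspose_mul, Matrix.mul_assoc, ← Matrix.mul_assoc U, h,
    Matrix.one_mul, trace_mul_comm]

lemma re_trace_conjTranspose_mul_self_mprod_le {n : ℕ} (b : Bool)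
    (A : Matrix (Fin n) (Fin n) ℂ) {U : Matrix (Fin n) (Fin n) ℂ}
    (hU : U ∈ unitaryGroup (Fin n) ℂ) :
    (trace ((mprod b A U)ᴴ * mprod b A U)).re ≤ (trace (Aᴴ * A)).re := by
  cases b
  · rw [re_trace_conjTranspose_mul_self, re_trace_conjTranspose_mul_self]
    refine Finset.sum_le_sum fun i _ => Finset.sum_le_sum fun j _ => ?_
    simp only [mprod, Bool.false_eq_true, if_false, hadamard_apply, norm_mul]
    gcongr
    exact mul_le_of_le_one_right (norm_nonneg _) (entry_norm_bound_of_unitary hU i j)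
  · exact (congrArg Complex.re (trace_conjTranspose_mul_self_mul_unitary A hU)).le

end Frobenius

section Hadamard

/-- The discrete Fourier matrix: its entries are unimodular and its columns are orthogonal. -/
lemma exists_unimodular_conjTranspose_mul_self_eq (n : ℕ) [NeZero n] :
    ∃ Q : Matrix (ZMod n) (Fin n) ℂ, (∀ a i, ‖Q a i‖ = 1) ∧
      Qᴴ * Q = (n : ℂ) • (1 : Matrix (Fin n) (Fin n) ℂ) := by
  refine ⟨Matrix.of fun a i => ZMod.stdAddChar (a * ((i : ℕ) : ZMod n)), fun a i => ?_, ?_⟩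
  · exact AddChar.norm_apply ZMod.stdAddChar (a * ((i : ℕ) : ZMod n))
  ext i j
  have h := AddChar.sum_mulShift (R := ZMod n) (R' := ℂ)
    (((j : ℕ) : ZMod n) - ((i : ℕ) : ZMod n)) (ZMod.isPrimitive_stdAddChar n)
  have hij : ((j : ℕ) : ZMod n) - ((i : ℕ) : ZMod n) = 0 ↔ i = j := by
    rw [sub_eq_zero, ZMod.natCast_eq_natCast_iff', Nat.mod_eq_of_lt j.2, Nat.mod_eq_of_lt i.2,
      Fin.ext_iff, eq_comm]
  simp only [mul_apply, conjTranspose_apply, Matrix.smul_apply, one_apply, smul_eq_mul,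
    mul_ite, mul_one, mul_zero]
  simp only [hij, ZMod.card] at h
  rw [← Nat.cast_zero, ← Nat.cast_ite, ← h]
  refine Finset.sum_congr rfl fun a _ => ?_
  rw [mul_sub, sub_eq_neg_add, AddChar.map_add_eq_mul, AddChar.map_neg_eq_conj]
  rfl

lemma diagonal_mem_unitaryGroup {n : Type*} [Fintype n] [DecidableEq n] {v : n → ℂ}
    (hv : ∀ i, ‖v i‖ = 1) : diagonal v ∈ unitaryGroup n ℂ := by
  rw [mem_unitaryGroup_iff, star_eq_conjTranspose, diagonal_conjTranspose, diagonal_mul_diagonal,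
    ← diagonal_one]
  congr 1
  ext i
  simp [Complex.mul_conj, Complex.normSq_eq_norm_sq, hv i]

lemma UnitarilyInvariantNorm.hadamard_le {n : ℕ} (Nn : UnitarilyInvariantNorm n)
    (B R : Matrix (Fin n) (Fin n) ℂ) :
    Nn.N (B ⊙ R) ≤ √(trace (Bᴴ * B)).re * Nn.N R := by
  obtain rfl | hn := Nat.eq_zero_or_pos n
  · rw [Subsingleton.elim (B ⊙ R) 0, Nn.map_zero]
    exact mul_nonneg (Real.sqrt_nonneg _) (Nn.nonneg R)
  have : NeZero n := ⟨hn.ne'⟩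
  obtain ⟨Q, hQ, hQQ⟩ := exists_unimodular_conjTranspose_mul_self_eq n
  have hQT : Qᵀ * Qᵀᴴ = (n : ℂ) • (1 : Matrix (Fin n) (Fin n) ℂ) := by
    rw [show Qᵀᴴ = Qᴴᵀ from rfl, ← transpose_mul, hQQ, transpose_smul, transpose_one]
  set C := Q * B * Qᵀ with hC
  have hinv : Qᴴ * C * Qᵀᴴ = ((n : ℂ) ^ 2) • B := by
    rw [hC, Matrix.mul_assoc, Matrix.mul_assoc, hQT, ← Matrix.mul_assoc, ← Matrix.mul_assoc, hQQ]
    simp [smul_smul, sq]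
  have hparseval : (trace (Cᴴ * C)).re = (n : ℝ) ^ 2 * (trace (Bᴴ * B)).re := by
    have : trace (Cᴴ * C) = (n : ℂ) ^ 2 * trace (Bᴴ * B) := by
      have hCt : Cᴴ = Qᵀᴴ * (Bᴴ * Qᴴ) := by simp [hC, conjTranspose_mul]
      calc trace (Cᴴ * C) = trace (Bᴴ * (Qᴴ * C * Qᵀᴴ)) := by
            rw [hCt, Matrix.mul_assoc, trace_mul_comm]
            simp only [Matrix.mul_assoc]
        _ = (n : ℂ) ^ 2 * trace (Bᴴ * B) := by
            rw [hinv, Matrix.mul_smul, trace_smul, smul_eq_mul]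
    rw [this, ← Nat.cast_pow, ← Nat.cast_pow, ← Complex.ofReal_natCast, Complex.re_ofReal_mul]
  have hsum : ((n : ℂ) ^ 2) • (B ⊙ R) = ∑ p : ZMod n × ZMod n,
      C p.1 p.2 • (diagonal (star (Q p.1)) * R * diagonal (star (Q p.2))) := by
    ext i j
    have h := congrFun₂ hinv i j
    simp only [mul_apply, conjTranspose_apply, transpose_apply, Matrix.smul_apply, smul_eq_mul] at h
    simp only [Matrix.smul_apply, hadamard_apply, smul_eq_mul, Matrix.sum_apply, mul_diagonal,
      diagonal_mul, ← mul_assoc, Pi.star_apply]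
    rw [← h, Finset.sum_mul, Fintype.sum_prod_type_right]
    simp only [Finset.sum_mul]
    refine Finset.sum_congr rfl fun b _ => Finset.sum_congr rfl fun a _ => ?_
    simp only [hC, mul_apply, transpose_apply]
    ring
  have hN : (n : ℝ) ^ 2 * Nn.N (B ⊙ R) ≤ (∑ p : ZMod n × ZMod n, ‖C p.1 p.2‖) * Nn.N R := by
    have h := Nn.homog ((n : ℂ) ^ 2) (B ⊙ R)
    rw [norm_pow, Complex.norm_natCast] at h
    rw [← h, hsum, Finset.sum_mul]
    refine (Nn.sum_le _ _).trans (Finset.sum_le_sum fun p _ => ?_)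
    rw [Nn.homog, Nn.unitary_inv] <;> exact diagonal_mem_unitaryGroup (by simp [hQ])
  have hCS : ∑ p : ZMod n × ZMod n, ‖C p.1 p.2‖ ≤ (n : ℝ) ^ 2 * √(trace (Bᴴ * B)).re := by
    have h := sq_sum_le_card_mul_sum_sq (s := Finset.univ)
      (f := fun p : ZMod n × ZMod n => ‖C p.1 p.2‖)
    have hC2 : ∑ p : ZMod n × ZMod n, ‖C p.1 p.2‖ ^ 2 = ∑ a, ∑ b, ‖C a b‖ ^ 2 :=
      Fintype.sum_prod_type _
    rw [hC2, ← re_trace_conjTranspose_mul_self, hparseval] at h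
    refine abs_le_of_sq_le_sq' ?_ (by positivity) |>.2
    have h0 : 0 ≤ (trace (Bᴴ * B)).re := by
      rw [re_trace_conjTranspose_mul_self]; positivity
    rw [mul_pow, Real.sq_sqrt h0]
    refine h.trans_eq ?_
    simp [ZMod.card]
    ring
  have hn2 : (0 : ℝ) < (n : ℝ) ^ 2 := by positivity
  refine le_of_mul_le_mul_left ?_ hn2
  rw [← mul_assoc]
  exact hN.trans (mul_le_mul_of_nonneg_right hCS (Nn.nonneg R))

end Hadamard

section Product

open scoped Matrix.Norms.L2Operator MatrixOrder

lemma l2_opNorm_le_sqrt_trace {n : ℕ} (A : Matrix (Fin n) (Fin n) ℂ) :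
    ‖A‖ ≤ √(trace (Aᴴ * A)).re := by
  rw [cstar_norm_def]
  refine ContinuousLinearMap.opNorm_le_bound _ (Real.sqrt_nonneg _) fun x => ?_
  rw [EuclideanSpace.norm_eq, EuclideanSpace.norm_eq, ← Real.sqrt_mul' _ (by positivity),
    re_trace_conjTranspose_mul_self, Finset.sum_mul]
  refine Real.sqrt_le_sqrt (Finset.sum_le_sum fun i _ => ?_)
  refine le_trans ?_ (Finset.sum_mul_sq_le_sq_mul_sq _ _ _)
  gcongr
  rw [ofLp_toEuclideanCLM]
  simp only [mulVec, dotProduct, ← norm_mul]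
  exact norm_sum_le _ _

namespace UnitarilyInvariantNorm

variable {n : ℕ} (Nn : UnitarilyInvariantNorm n)

lemma mul_le_of_isSelfAdjoint_of_norm_le_one {H : Matrix (Fin n) (Fin n) ℂ}
    (hH : IsSelfAdjoint H) (h1 : ‖H‖ ≤ 1) (R : Matrix (Fin n) (Fin n) ℂ) :
    Nn.N (H * R) ≤ Nn.N R := by
  have hU := hH.self_add_I_smul_cfcSqrt_sub_sq_mem_unitary H h1
  set S := CFC.sqrt (1 - H ^ 2)
  have hSs : IsSelfAdjoint S := (CFC.sqrt_nonneg (1 - H ^ 2)).isSelfAdjoint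
  set U := H + Complex.I • S with hUdef
  have hsum : H * R = (2⁻¹ : ℂ) • (U * R + star U * R) := by
    rw [← Matrix.add_mul, ← Matrix.smul_mul]
    congr 1
    rw [hUdef, star_add, star_smul, hH.star_eq, hSs.star_eq, Complex.star_def, Complex.conj_I]
    module
  rw [hsum, Nn.homog]
  have h := Nn.triangle (U * R) (star U * R)
  rw [Nn.unitary_mul hU, Nn.unitary_mul (Unitary.star_mem hU)] at h
  norm_num
  linarith

lemma mul_le_of_isSelfAdjoint {H : Matrix (Fin n) (Fin n) ℂ}
    (hH : IsSelfAdjoint H) (R : Matrix (Fin n) (Fin n) ℂ) :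
    Nn.N (H * R) ≤ ‖H‖ * Nn.N R := by
  obtain rfl | h0 := eq_or_ne H 0
  · simp [Nn.map_zero]
  have hpos : 0 < ‖H‖ := norm_pos_iff.mpr h0
  have h := Nn.mul_le_of_isSelfAdjoint_of_norm_le_one (H := ((‖H‖⁻¹ : ℝ) : ℂ) • H)
    (by simp [IsSelfAdjoint, star_smul, hH.star_eq])
    (by rw [norm_smul]; simp [hpos.ne']) R
  rw [Matrix.smul_mul, Nn.homog, Complex.norm_real, norm_inv, norm_norm, inv_mul_le_iff₀ hpos] at h
  exact h

lemma mul_le_of_isUnit {A : Matrix (Fin n) (Fin n) ℂ} (hA : IsUnit A)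
    (R : Matrix (Fin n) (Fin n) ℂ) : Nn.N (A * R) ≤ ‖A‖ * Nn.N R := by
  set H := CFC.abs A
  have hHs : IsSelfAdjoint H := (CFC.abs_nonneg A).isSelfAdjoint
  have hHH : H * H = star A * A := CFC.abs_mul_abs A
  have hH : IsUnit H.det := by
    have : IsUnit (H * H) := hHH ▸ (hA.star.mul hA)
    rw [isUnit_iff_isUnit_det, det_mul] at this
    exact isUnit_of_mul_isUnit_left this
  have hW : A * H⁻¹ ∈ unitaryGroup (Fin n) ℂ := by
    rw [mem_unitaryGroup_iff', star_mul, star_eq_conjTranspose H⁻¹, conjTranspose_nonsing_inv,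
      ← star_eq_conjTranspose H, hHs.star_eq, Matrix.mul_assoc, ← Matrix.mul_assoc (star A), ← hHH,
      Matrix.mul_assoc H, mul_nonsing_inv H hH, Matrix.mul_one, nonsing_inv_mul H hH]
  have hA' : A * R = A * H⁻¹ * (H * R) := by
    rw [Matrix.mul_assoc, nonsing_inv_mul_cancel_left _ _ hH]
  rw [hA', Nn.unitary_mul hW, ← CFC.norm_abs (a := A)]
  exact Nn.mul_le_of_isSelfAdjoint hHs R

lemma mul_le_l2_opNorm_mul (A R : Matrix (Fin n) (Fin n) ℂ) :
    Nn.N (A * R) ≤ ‖A‖ * Nn.N R := by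
  refine le_of_forall_pos_le_add fun δ hδ => ?_
  have hR := Nn.nonneg R
  obtain ⟨ε, ⟨hε0, hε⟩, hmem⟩ : ∃ ε ∈ Set.Ioo (0 : ℝ) (δ / (2 * (Nn.N R + 1))),
      (ε : ℂ) ∉ spectrum ℂ A := by
    have hfin : ((fun x : ℝ => (x : ℂ)) ⁻¹' spectrum ℂ A).Finite :=
      A.finite_spectrum.preimage Complex.ofReal_injective.injOn
    exact ((Set.Ioo_infinite (by positivity)).sdiff hfin).nonempty
  have hunit : IsUnit (A - (ε : ℂ) • (1 : Matrix (Fin n) (Fin n) ℂ)) := by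
    rw [spectrum.notMem_iff, Algebra.algebraMap_eq_smul_one] at hmem
    simpa using hmem.neg
  have h1 := Nn.mul_le_of_isUnit hunit R
  have hnorm : ‖A - (ε : ℂ) • (1 : Matrix (Fin n) (Fin n) ℂ)‖ ≤ ‖A‖ + ε := by
    refine (norm_sub_le _ _).trans ?_
    rw [norm_smul, Complex.norm_real, Real.norm_of_nonneg hε0.le]
    have : ‖(1 : Matrix (Fin n) (Fin n) ℂ)‖ ≤ 1 := by
      rw [cstar_norm_def, _root_.map_one]
      exact ContinuousLinearMap.norm_id_le
    gcongr
    exact mul_le_of_le_one_right hε0.le this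
  have h2 := Nn.triangle ((A - (ε : ℂ) • (1 : Matrix (Fin n) (Fin n) ℂ)) * R) ((ε : ℂ) • R)
  rw [show (A - (ε : ℂ) • (1 : Matrix (Fin n) (Fin n) ℂ)) * R + (ε : ℂ) • R = A * R by
    simp [Matrix.sub_mul], Nn.homog, Complex.norm_real, Real.norm_of_nonneg hε0.le] at h2
  have h3 := mul_le_mul_of_nonneg_right hnorm hR
  rw [lt_div_iff₀ (by positivity)] at hε
  linarith

end UnitarilyInvariantNorm

end Product

/-- For `A, R ∈ M_n(ℂ)`, `U` unitary and `‖·‖` a unitarily invariant norm,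
`‖A ⬝ U ⬝ R‖ ≤ √(tr(AᴴA)) ‖R‖`, where each of the two products can be either the
ordinary matrix product or the Hadamard product. -/
theorem uinorm_mul_unitary_mul_le_sqrt_trace_mul
    (n : ℕ) (A R U : Matrix (Fin n) (Fin n) ℂ)
    (hU : U ∈ Matrix.unitaryGroup (Fin n) ℂ)
    (Nn : UnitarilyInvariantNorm n) (b₁ b₂ : Bool) :
    Nn.N (mprod b₂ (mprod b₁ A U) R) ≤
      Real.sqrt ((Matrix.trace (Aᴴ * A)).re) * Nn.N R := by
  have hF : √(trace ((mprod b₁ A U)ᴴ * mprod b₁ A U)).re ≤ √(trace (Aᴴ * A)).re :=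
    Real.sqrt_le_sqrt (re_trace_conjTranspose_mul_self_mprod_le b₁ A hU)
  refine le_trans ?_ (mul_le_mul_of_nonneg_right hF (Nn.nonneg R))
  cases b₂
  · exact Nn.hadamard_le _ R
  · exact (Nn.mul_le_l2_opNorm_mul _ R).trans
      (mul_le_mul_of_nonneg_right (l2_opNorm_le_sqrt_trace _) (Nn.nonneg R))
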